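/- Fix real Hecke parameters κ,λ,υ,ς, a step size s>0, and 0<q<1. Let x,z∈ℂ be such that all the c-function values below are defined (their theta denominators θ(q^{∓2z}, d_s q^{±x};q^s) and θ(q^{∓2x}, d̃_s q^{±z};q^s) are nonzero). Then the normalized c-function satisfies: c(x,z)·c^d(z,−x)·c^d(−z,−x) + c(−x,z)·c^d(z,x)·c^d(−z,−x) = c(x,z)·c(−x,z)·c^d(−z,−x) + c(x,z)·c(−x,−z)·c^d(z,−x). -/

import Mathlib

noncomputable section

/-- `qc q x = q^x := exp(x·log q)` for a real base `q` and complex exponent `x`. -/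
def qc (q : ℝ) (x : ℂ) : ℂ := Complex.exp (x * Complex.log (q : ℂ))

/-- Finite q-shifted factorial `(a;p)_n`. -/
def qPoch (a p : ℂ) (n : ℕ) : ℂ := ∏ i ∈ Finset.range n, (1 - a * p ^ i)

/-- Infinite q-shifted factorial `(a;p)_∞`. -/
def qPochInf (a p : ℂ) : ℂ := ∏' i : ℕ, (1 - a * p ^ i)

/-- Very-well-poised basic hypergeometric series `₈W₇(a₀;a₁,…,a₅;p,u)`. -/
def W8 (a0 a1 a2 a3 a4 a5 p u : ℂ) : ℂ :=
  ∑' r : ℕ, ((1 - a0 * p ^ (2 * r)) / (1 - a0)) * u ^ r *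
    ((qPoch a0 p r * qPoch a1 p r * qPoch a2 p r * qPoch a3 p r * qPoch a4 p r *
        qPoch a5 p r) /
      (qPoch (p * a0 / a0) p r * qPoch (p * a0 / a1) p r * qPoch (p * a0 / a2) p r *
        qPoch (p * a0 / a3) p r * qPoch (p * a0 / a4) p r * qPoch (p * a0 / a5) p r))

/-- All the "denominator" factors of the `₈W₇` series are nonzero. -/
def W8Denom (a0 a1 a2 a3 a4 a5 p : ℂ) : Prop :=
  1 - a0 ≠ 0 ∧ ∀ r : ℕ,
    qPoch (p * a0 / a0) p r ≠ 0 ∧ qPoch (p * a0 / a1) p r ≠ 0 ∧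
    qPoch (p * a0 / a2) p r ≠ 0 ∧ qPoch (p * a0 / a3) p r ≠ 0 ∧
    qPoch (p * a0 / a4) p r ≠ 0 ∧ qPoch (p * a0 / a5) p r ≠ 0

/-- Basic hypergeometric series `₄φ₃(a₁,a₂,a₃,a₄;b₁,b₂,b₃;p,u)`. -/
def phi43 (a1 a2 a3 a4 b1 b2 b3 p u : ℂ) : ℂ :=
  ∑' j : ℕ, (qPoch a1 p j * qPoch a2 p j * qPoch a3 p j * qPoch a4 p j) * u ^ j /
    (qPoch p p j * qPoch b1 p j * qPoch b2 p j * qPoch b3 p j)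

/-- Modified Jacobi theta function `θ(u;p)`. -/
def theta (u p : ℂ) : ℂ := qPochInf u p * qPochInf (p / u) p

/-- Askey–Wilson parameter `a_s = q^{κ+λ}`. -/
def aP (q : ℝ) (k lm : ℝ) : ℂ := qc q (k + lm)

/-- Askey–Wilson parameter `b_s = -q^{κ-λ}`. -/
def bP (q : ℝ) (k lm : ℝ) : ℂ := -qc q (k - lm)

/-- Askey–Wilson parameter `c_s = q^{s/2+υ+ς}`. -/
def cP (q : ℝ) (s up sg : ℝ) : ℂ := qc q (s / 2 + up + sg)

/-- Askey–Wilson parameter `d_s = -q^{s/2+υ-ς}`. -/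
def dP (q : ℝ) (s up sg : ℝ) : ℂ := -qc q (s / 2 + up - sg)

/-- The weight `W(x,z) = q^{(κ+λ+x)(κ+υ+z)/s}`. -/
def Wgt (q s k lm up : ℝ) (x z : ℂ) : ℂ := qc q ((k + lm + x) * (k + up + z) / s)

/-- The singular term `St(x)`; dual version is obtained by swapping `lm` and `up`. -/
def St (q s k lm up sg : ℝ) (x : ℂ) : ℂ :=
  qPochInf (qc q (s + x) / aP q k lm) (qc q s) * qPochInf (qc q (s + x) / bP q k lm) (qc q s) *
  qPochInf (qc q (s + x) / cP q s up sg) (qc q s) *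
  qPochInf (qc q (s + x) / dP q s up sg) (qc q s)

/-- The series part `Ψ(x,z)` of the asymptotically free eigenfunction. -/
def Psi (q s k lm up sg : ℝ) (x z : ℂ) : ℂ :=
  (qPochInf (qc q (s + x + z) * aP q k lm / aP q k up) (qc q s) *
   qPochInf (qc q (s + x + z) * bP q k lm / aP q k up) (qc q s) *
   qPochInf (qc q (s + x + z) * cP q s up sg / aP q k up) (qc q s) *
   qPochInf (qc q (s + x + z) * aP q k up / dP q s up sg) (qc q s) *
   qPochInf (qc q (s + 2 * z)) (qc q s) *
   qPochInf (dP q s up sg * qc q x) (qc q s) /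
   qPochInf (qc q (2 * s + x + 2 * z) / dP q s up sg) (qc q s)) *
  W8 (qc q (s + x + 2 * z) / dP q s up sg) (qc q (s + z) / aP q k up)
     (qc q (s + z) / dP q s lm sg) (bP q k up * qc q z) (cP q s lm sg * qc q z)
     (qc q (s + x) / dP q s up sg) (qc q s) (dP q s up sg * qc q x)

/-- The asymptotically free eigenfunction `Φ(x,z;κ,λ,υ,ς;q,s)`. -/
def Phi (q s k lm up sg : ℝ) (x z : ℂ) : ℂ :=
  Wgt q s k lm up x z * Psi q s k lm up sg x z /
    (St q s k lm up sg x * St q s k up lm sg z)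

/-- The Askey–Wilson function `E(x,z;κ,λ,υ,ς;q,s)`. -/
def AWE (q s k lm up sg : ℝ) (x z : ℂ) : ℂ :=
  (qPochInf (aP q k up * qc q (s + z - x) / dP q s up sg) (qc q s) *
   qPochInf (aP q k up * qc q (s + z + x) / dP q s up sg) (qc q s) *
   qPochInf (aP q k lm * bP q k lm) (qc q s) *
   qPochInf (aP q k lm * cP q s up sg) (qc q s) *
   qPochInf (qc q s * aP q k lm / dP q s up sg) (qc q s)) /
  (qPochInf (qc q (s + x) / dP q s up sg) (qc q s) *
   qPochInf (qc q (s - x) / dP q s up sg) (qc q s) *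
   qPochInf (qc q (s + z) / dP q s lm sg) (qc q s) *
   qPochInf (aP q k up * bP q k up * cP q s lm sg * qc q z) (qc q s)) *
  W8 (aP q k up * bP q k up * cP q s lm sg * qc q (-s + z))
     (aP q k lm * qc q x) (aP q k lm * qc q (-x)) (aP q k up * qc q z)
     (bP q k up * qc q z) (cP q s lm sg * qc q z) (qc q s) (qc q (s - z) / dP q s lm sg)

/-- The normalized `c`-function; the dual version swaps `lm` and `up`. -/
def cF (q s k lm up sg : ℝ) (x z : ℂ) : ℂ :=
  (theta (aP q k up * qc q (-z)) (qc q s) * theta (bP q k up * qc q (-z)) (qc q s) *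
   theta (cP q s lm sg * qc q (-z)) (qc q s) *
   theta (dP q s up sg * qc q (x - z) / aP q k up) (qc q s)) /
  (Wgt q s k lm up x z *
    (theta (qc q (-(2 * z))) (qc q s) * theta (dP q s up sg * qc q x) (qc q s)))

/-- The coefficient `A(x)` of the Askey–Wilson difference operator. -/
def AOp (q s k lm up sg : ℝ) (x : ℂ) : ℂ :=
  ((1 - aP q k lm * qc q x) * (1 - bP q k lm * qc q x) * (1 - cP q s up sg * qc q x) *
    (1 - dP q s up sg * qc q x)) /
  (aP q k up * (1 - qc q (2 * x)) * (1 - qc q (s + 2 * x)))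

open Filter Topology

theorem summable_exp_quadratic {c : ℂ} (hc : c.re < 0) (w : ℂ) :
    Summable fun k : ℤ => Complex.exp (c * k ^ 2 + k * w) := by
  have hpi : (Real.pi : ℂ) ≠ 0 := by exact_mod_cast Real.pi_ne_zero
  have h := (summable_jacobiTheta₂_term_iff (w / (2 * Real.pi * Complex.I))
    (c / (Real.pi * Complex.I))).2 (by
      have : c / (Real.pi * Complex.I) = -(c * Complex.I) / ((Real.pi : ℝ) : ℂ) := by
        field_simp; simp
      rw [this, Complex.div_ofReal_im]
      simp only [Complex.neg_im, Complex.mul_I_im]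
      exact div_pos (by linarith) Real.pi_pos)
  refine h.congr fun k => ?_
  simp only [jacobiTheta₂_term]
  congr 1
  field_simp
  ring

theorem multipliable_qPochInf {p : ℂ} (hp : ‖p‖ < 1) (a : ℂ) :
    Multipliable fun i : ℕ => 1 - a * p ^ i := by
  have h : Summable fun i : ℕ => ‖-(a * p ^ i)‖ := by
    simpa using (summable_geometric_of_lt_one (norm_nonneg p) hp).mul_left ‖a‖
  simpa [sub_eq_add_neg] using multipliable_one_add_of_summable h

theorem tendsto_qPoch {p : ℂ} (hp : ‖p‖ < 1) (a : ℂ) :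
    Tendsto (qPoch a p) atTop (𝓝 (qPochInf a p)) :=
  (multipliable_qPochInf hp a).tendsto_prod_tprod_nat

theorem qPochInf_ne_zero {p : ℂ} (hp : ‖p‖ < 1) (a : ℂ) (h : ∀ i : ℕ, 1 - a * p ^ i ≠ 0) :
    qPochInf a p ≠ 0 := by
  have hs : Summable fun i : ℕ => ‖-(a * p ^ i)‖ := by
    simpa using (summable_geometric_of_lt_one (norm_nonneg p) hp).mul_left ‖a‖
  have := tprod_one_add_ne_zero_of_summable (f := fun i : ℕ => -(a * p ^ i))
    (fun i => by simpa [sub_eq_add_neg] using h i) hs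
  simpa [qPochInf, sub_eq_add_neg] using this

theorem qPochInf_eq_mul {p : ℂ} (hp : ‖p‖ < 1) (a : ℂ) :
    qPochInf a p = (1 - a) * qPochInf (p * a) p := by
  have h : (fun i : ℕ => 1 - a * p ^ (i + 1)) = fun i : ℕ => 1 - p * a * p ^ i := by
    funext i; ring
  rw [qPochInf, tprod_eq_zero_mul' (by rw [h]; exact multipliable_qPochInf hp _), h]
  simp [qPochInf]

theorem theta_div {p u : ℂ} (hp0 : p ≠ 0) : theta (p / u) p = theta u p := by
  rw [theta, theta, div_div_cancel₀ hp0, mul_comm]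

theorem theta_inv {p u : ℂ} (hp : ‖p‖ < 1) (hu : u ≠ 0) :
    u * theta u⁻¹ p = -theta u p := by
  rw [theta, theta, qPochInf_eq_mul hp u⁻¹, qPochInf_eq_mul hp u, div_inv_eq_mul,
    ← div_eq_mul_inv]
  field_simp
  ring

/-- The reciprocal `1 / (p;p)_m`, extended by zero to negative integers `m`. -/
def qFactInv (p : ℂ) : ℤ → ℂ
  | Int.ofNat m => (qPoch p p m)⁻¹
  | Int.negSucc _ => 0

theorem qPoch_self_ne_zero {p : ℂ} (hp : ‖p‖ < 1) (i : ℕ) : 1 - p * p ^ i ≠ 0 := by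
  rw [← pow_succ', sub_ne_zero]
  intro h
  have h1 := congrArg norm h
  rw [norm_one, norm_pow] at h1
  exact absurd h1.symm (pow_lt_one₀ (norm_nonneg p) hp (by omega)).ne

theorem qFactInv_sub_one {p : ℂ} (hp : ‖p‖ < 1) (m : ℤ) :
    qFactInv p (m - 1) = (1 - p ^ m) * qFactInv p m := by
  rcases m with m | m
  · rcases m with _ | m
    · rw [show Int.ofNat 0 - 1 = Int.negSucc 0 from rfl]
      simp [qFactInv]
    · have h : Int.ofNat (m + 1) - 1 = Int.ofNat m := by simp
      rw [h]
      simp only [qFactInv, qPoch, Finset.prod_range_succ, mul_inv]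
      have := qPoch_self_ne_zero hp m
      rw [show p ^ Int.ofNat (m + 1) = p * p ^ m by
        rw [Int.ofNat_eq_natCast, zpow_natCast, pow_succ']]
      field_simp
  · simp [qFactInv, show Int.negSucc m - 1 = Int.negSucc (m + 1) from rfl]

theorem tendsto_qFactInv {p : ℂ} (hp : ‖p‖ < 1) :
    Tendsto (qFactInv p) atTop (𝓝 (qPochInf p p)⁻¹) := by
  have h := (tendsto_qPoch hp p).inv₀ (qPochInf_ne_zero hp p (qPoch_self_ne_zero hp))
  have h2 : Tendsto (fun m : ℤ => (qPoch p p m.toNat)⁻¹) atTop (𝓝 (qPochInf p p)⁻¹) :=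
    h.comp (tendsto_atTop_atTop.2 fun b => ⟨b, fun a ha => by omega⟩)
  refine h2.congr' ?_
  filter_upwards [eventually_ge_atTop 0] with m hm
  obtain ⟨n, rfl⟩ := Int.eq_ofNat_of_zero_le hm
  rfl

theorem exists_norm_qFactInv_le {p : ℂ} (hp : ‖p‖ < 1) : ∃ M, ∀ m, ‖qFactInv p m‖ ≤ M := by
  have h := (tendsto_qPoch hp p).inv₀ (qPochInf_ne_zero hp p (qPoch_self_ne_zero hp))
  obtain ⟨M, hM⟩ := (Metric.isBounded_range_of_tendsto _ h).exists_norm_le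
  refine ⟨M, fun m => ?_⟩
  rcases m with m | m
  · exact hM _ ⟨m, rfl⟩
  · simpa [qFactInv] using (norm_nonneg _).trans (hM _ ⟨0, rfl⟩)

/-- The general term `p^(k(k-1)/2) e^(kw)` of the Jacobi triple product, where `p = e^c`. -/
def tripleTerm (c w : ℂ) (k : ℤ) : ℂ := Complex.exp (c * (k ^ 2 - k) / 2 + k * w)

theorem tripleTerm_succ (c w : ℂ) (k : ℤ) :
    tripleTerm c w (k + 1) = Complex.exp c ^ k * Complex.exp w * tripleTerm c w k := by
  rw [tripleTerm, tripleTerm, ← Complex.exp_int_mul, ← Complex.exp_add, ← Complex.exp_add]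
  congr 1
  push_cast
  ring

theorem summable_tripleTerm {c : ℂ} (hc : c.re < 0) (w : ℂ) : Summable (tripleTerm c w) := by
  refine (summable_exp_quadratic (c := c / 2) (by simpa using by linarith) (w - c / 2)).congr
    fun k => ?_
  rw [tripleTerm]
  congr 1
  ring

theorem hasSum_finite_triple {c : ℂ} (hc : ‖Complex.exp c‖ < 1) (w : ℂ) (n : ℕ) :
    HasSum (fun k : ℤ => qPoch (Complex.exp c) (Complex.exp c) (2 * n) *
        (qFactInv (Complex.exp c) (n - k) * qFactInv (Complex.exp c) (n + k)) * tripleTerm c w k)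
      (qPoch (-Complex.exp w) (Complex.exp c) n *
        qPoch (Complex.exp c / -Complex.exp w) (Complex.exp c) n) := by
  set p := Complex.exp c with hp
  have hp0 : p ≠ 0 := Complex.exp_ne_zero c
  have hw0 : Complex.exp w ≠ 0 := Complex.exp_ne_zero w
  induction n with
  | zero =>
    have h := hasSum_single (f := fun k : ℤ => qPoch p p (2 * 0) *
        (qFactInv p ((0 : ℕ) - k) * qFactInv p ((0 : ℕ) + k)) * tripleTerm c w k) 0 (by
      intro k hk
      rcases k with k | k
      · rcases k with _ | k
        · exact absurd rfl hk
        · have : ((0 : ℕ) : ℤ) - Int.ofNat (k + 1) = Int.negSucc k := by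
            simp [Int.negSucc_eq]
          simp only [this, qFactInv, zero_mul, mul_zero]
      · simp [qFactInv])
    have h0 : qFactInv p 0 = 1 := by
      change (qPoch p p 0)⁻¹ = 1
      simp [qPoch]
    simpa [qPoch, h0, tripleTerm] using h
  | succ n ih =>
    have hl := ((Equiv.subRight (1 : ℤ)).hasSum_iff.2 ih).mul_left (p ^ n * Complex.exp w)
    have hr := ((Equiv.addRight (1 : ℤ)).hasSum_iff.2 ih).mul_left (p ^ (n + 1) / Complex.exp w)
    have h := ((ih.mul_left (1 + p ^ (2 * n + 1))).add hl).add hr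
    have hval : qPoch (-Complex.exp w) p (n + 1) * qPoch (p / -Complex.exp w) p (n + 1) =
        (1 + p ^ (2 * n + 1)) * (qPoch (-Complex.exp w) p n * qPoch (p / -Complex.exp w) p n) +
        p ^ n * Complex.exp w * (qPoch (-Complex.exp w) p n * qPoch (p / -Complex.exp w) p n) +
        p ^ (n + 1) / Complex.exp w *
          (qPoch (-Complex.exp w) p n * qPoch (p / -Complex.exp w) p n) := by
      simp only [qPoch, Finset.prod_range_succ]
      field_simp
      ring
    rw [hval]
    refine (congrArg (fun f => HasSum f _) (funext fun k => ?_)).mp h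
    simp only [Function.comp_apply, Equiv.subRight_apply, Equiv.coe_addRight]
    have e1 : tripleTerm c w k = p ^ (k - 1) * Complex.exp w * tripleTerm c w (k - 1) := by
      simpa using tripleTerm_succ c w (k - 1)
    have e2 := tripleTerm_succ c w k
    rw [← hp] at e2
    have f1 := qFactInv_sub_one hc ((n : ℤ) + 1 - k)
    have f2 := qFactInv_sub_one hc ((n : ℤ) + 1 + k)
    have f3 := qFactInv_sub_one hc ((n : ℤ) + k)
    have f4 := qFactInv_sub_one hc ((n : ℤ) - k)
    rw [show (n : ℤ) + 1 - k - 1 = n - k by ring] at f1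
    rw [show (n : ℤ) + 1 + k - 1 = n + k by ring] at f2
    rw [show ((n + 1 : ℕ) : ℤ) - k = n + 1 - k by push_cast; ring,
      show ((n + 1 : ℕ) : ℤ) + k = n + 1 + k by push_cast; ring,
      show (n : ℤ) - (k - 1) = n + 1 - k by ring, show (n : ℤ) + (k - 1) = n + k - 1 by ring,
      show (n : ℤ) - (k + 1) = n - k - 1 by ring, show (n : ℤ) + (k + 1) = n + 1 + k by ring,
      f3, f4, f1, f2, e2, e1, show 2 * (n + 1) = 2 * n + 1 + 1 by ring]
    simp only [qPoch, Finset.prod_range_succ]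
    simp only [zpow_sub₀ hp0, zpow_add₀ hp0, zpow_natCast, zpow_one]
    have hk : p ^ k ≠ 0 := zpow_ne_zero _ hp0
    field_simp
    ring

/-- The Jacobi triple product, up to the value of the normalizing constant. -/
theorem theta_eq_tsum {c : ℂ} (hc : c.re < 0) (w : ℂ) :
    theta (-Complex.exp w) (Complex.exp c) =
      (qPochInf (Complex.exp c) (Complex.exp c))⁻¹ * ∑' k : ℤ, tripleTerm c w k := by
  have hp : ‖Complex.exp c‖ < 1 := by rw [Complex.norm_exp]; simpa using hc
  set p := Complex.exp c with hpc
  have hl : qPochInf p p ≠ 0 := qPochInf_ne_zero hp p (qPoch_self_ne_zero hp)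
  obtain ⟨M, hM⟩ := exists_norm_qFactInv_le hp
  obtain ⟨B, hB⟩ := (Metric.isBounded_range_of_tendsto _ (tendsto_qPoch hp p)).exists_norm_le
  have hM0 : 0 ≤ M := (norm_nonneg _).trans (hM 0)
  have hB0 : 0 ≤ B := (norm_nonneg _).trans (hB _ ⟨0, rfl⟩)
  have key := tendsto_tsum_of_dominated_convergence (𝓕 := atTop)
    (f := fun (n : ℕ) (k : ℤ) => qPoch p p (2 * n) *
      (qFactInv p (n - k) * qFactInv p (n + k)) * tripleTerm c w k)
    (g := fun k => qPochInf p p * ((qPochInf p p)⁻¹ * (qPochInf p p)⁻¹) * tripleTerm c w k)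
    (bound := fun k => B * (M * M) * ‖tripleTerm c w k‖)
    ((summable_tripleTerm hc w).norm.mul_left _)
    (fun k => by
      refine Tendsto.mul_const _ (Tendsto.mul ?_ (Tendsto.mul ?_ ?_))
      · exact (tendsto_qPoch hp p).comp
          (tendsto_atTop_atTop.2 fun b => ⟨b, fun a ha => by omega⟩)
      · exact (tendsto_qFactInv hp).comp
          (tendsto_atTop_atTop.2 fun b => ⟨(b + k).toNat, fun a ha => by omega⟩)
      · exact (tendsto_qFactInv hp).comp
          (tendsto_atTop_atTop.2 fun b => ⟨(b - k).toNat, fun a ha => by omega⟩))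
    (Eventually.of_forall fun n k => by
      rw [norm_mul, norm_mul, norm_mul]
      have := hB _ ⟨2 * n, rfl⟩
      gcongr
      · exact hM _
      · exact hM _)
  replace key := key.congr fun n => (hasSum_finite_triple hp w n).tsum_eq
  have h2 := (tendsto_qPoch hp (-Complex.exp w)).mul (tendsto_qPoch hp (p / -Complex.exp w))
  rw [theta, tendsto_nhds_unique h2 key, tsum_mul_left]
  field_simp

/-- The general term of the even part of the product of two triple product series. -/
def evenTerm (c x : ℂ) (a : ℤ) : ℂ := Complex.exp (c * a ^ 2 + 2 * a * x)

/-- The general term of the odd part of the product of two triple product series. -/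
def oddTerm (c x : ℂ) (a : ℤ) : ℂ := Complex.exp (c * (a ^ 2 + a) + (2 * a + 1) * x)

theorem summable_evenTerm {c : ℂ} (hc : c.re < 0) (x : ℂ) : Summable (evenTerm c x) := by
  refine (summable_exp_quadratic hc (2 * x)).congr fun k => ?_
  rw [evenTerm]
  congr 1
  ring

theorem summable_oddTerm {c : ℂ} (hc : c.re < 0) (x : ℂ) : Summable (oddTerm c x) := by
  refine ((summable_exp_quadratic hc (c + 2 * x)).mul_left (Complex.exp x)).congr fun k => ?_
  rw [oddTerm, ← Complex.exp_add]
  congr 1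
  ring

/-- Pairs of integers, split according to the parity of their sum. -/
def intPairParity : (ℤ × ℤ) ⊕ (ℤ × ℤ) ≃ ℤ × ℤ :=
  Equiv.ofBijective
    (Sum.elim (fun t => (t.1 + t.2, t.1 - t.2)) fun t => (t.1 + t.2 + 1, t.1 - t.2)) (by
      constructor
      · rintro (⟨a, b⟩ | ⟨a, b⟩) (⟨a', b'⟩ | ⟨a', b'⟩) h <;>
          simp only [Sum.elim_inl, Sum.elim_inr, Prod.mk.injEq] at h
        · congr 2 <;> omega
        · omega
        · omega
        · congr 2 <;> omega
      · rintro ⟨m, n⟩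
        rcases Int.emod_two_eq_zero_or_one (m + n) with h | h
        · refine ⟨Sum.inl ((m + n) / 2, (m - n) / 2), ?_⟩
          simp only [Sum.elim_inl, Prod.mk.injEq]
          omega
        · refine ⟨Sum.inr ((m + n) / 2, (m - n) / 2), ?_⟩
          simp only [Sum.elim_inr, Prod.mk.injEq]
          omega)

theorem intPairParity_inl (t : ℤ × ℤ) : intPairParity (Sum.inl t) = (t.1 + t.2, t.1 - t.2) := rfl

theorem intPairParity_inr (t : ℤ × ℤ) :
    intPairParity (Sum.inr t) = (t.1 + t.2 + 1, t.1 - t.2) := rfl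

theorem hasSum_mul_prod {ι ι' : Type*} {f : ι → ℂ} {g : ι' → ℂ} (hf : Summable f)
    (hg : Summable g) :
    HasSum (fun t : ι × ι' => f t.1 * g t.2) ((∑' i, f i) * ∑' j, g j) := by
  rw [tsum_mul_tsum_of_summable_norm hf.norm hg.norm]
  exact (summable_mul_of_summable_norm hf.norm hg.norm).hasSum

theorem tsum_triple_mul_tsum_triple {c : ℂ} (hc : c.re < 0) (x y : ℂ) :
    (∑' k, tripleTerm c (x + y + Real.pi * Complex.I) k) *
        (∑' k, tripleTerm c (x - y + Real.pi * Complex.I) k) =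
      Complex.exp x * ((∑' k, oddTerm c x k) * (∑' k, evenTerm c y k) -
        (∑' k, evenTerm c x k) * ∑' k, oddTerm c y k) := by
  have h := hasSum_mul_prod (summable_tripleTerm hc (x + y + Real.pi * Complex.I))
    (summable_tripleTerm hc (x - y + Real.pi * Complex.I))
  have h1 := (hasSum_mul_prod ((Equiv.subRight (1 : ℤ)).summable_iff.2 (summable_oddTerm hc x))
    (summable_evenTerm hc y)).mul_left (Complex.exp x)
  have h2 := (hasSum_mul_prod (summable_evenTerm hc x)
    (summable_oddTerm hc y)).mul_left (-Complex.exp x)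
  simp only [Function.comp_apply] at h1
  rw [(Equiv.subRight (1 : ℤ)).tsum_eq (oddTerm c x)] at h1
  have h3 := HasSum.sum (f := (fun t : ℤ × ℤ => tripleTerm c (x + y + Real.pi * Complex.I) t.1 *
    tripleTerm c (x - y + Real.pi * Complex.I) t.2) ∘ intPairParity)
    (a := _) (b := _)
    ((congrArg (fun f => HasSum f _) (funext fun t => ?_)).mp h1)
    ((congrArg (fun f => HasSum f _) (funext fun t => ?_)).mp h2)
  · rw [h.unique (intPairParity.hasSum_iff.1 h3)]
    ring
  · obtain ⟨a, b⟩ := t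
    simp only [Function.comp_apply, intPairParity_inl, Equiv.subRight_apply, oddTerm, evenTerm,
      tripleTerm, ← Complex.exp_add]
    refine Complex.exp_eq_exp_iff_exists_int.2 ⟨-a, ?_⟩
    push_cast
    ring
  · obtain ⟨a, b⟩ := t
    simp only [Function.comp_apply, intPairParity_inr, oddTerm, evenTerm, tripleTerm,
      ← Complex.exp_add, neg_mul]
    rw [neg_eq_neg_one_mul, ← Complex.exp_pi_mul_I, ← Complex.exp_add]
    refine Complex.exp_eq_exp_iff_exists_int.2 ⟨-a, ?_⟩
    push_cast
    ring

theorem exists_theta_mul_theta {p : ℂ} (hp0 : p ≠ 0) (hp : ‖p‖ < 1) :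
    ∃ E O : ℂ → ℂ, ∀ x y : ℂ, x ≠ 0 → y ≠ 0 →
      theta (x * y) p * theta (x / y) p = x * (O x * E y - E x * O y) := by
  have hc : (Complex.log p).re < 0 := by
    rw [Complex.log_re]
    exact Real.log_neg (norm_pos_iff.2 hp0) hp
  refine ⟨fun x => (qPochInf p p)⁻¹ * ∑' k, evenTerm (Complex.log p) (Complex.log x) k,
    fun x => (qPochInf p p)⁻¹ * ∑' k, oddTerm (Complex.log p) (Complex.log x) k,
    fun x y hx hy => ?_⟩
  have h1 := theta_eq_tsum hc (Complex.log x + Complex.log y + Real.pi * Complex.I)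
  have h2 := theta_eq_tsum hc (Complex.log x - Complex.log y + Real.pi * Complex.I)
  have h3 := tsum_triple_mul_tsum_triple hc (Complex.log x) (Complex.log y)
  simp only [Complex.exp_add, Complex.exp_sub, Complex.exp_pi_mul_I, Complex.exp_log hp0,
    Complex.exp_log hx, Complex.exp_log hy, mul_neg, mul_one, neg_neg] at h1 h2 h3
  rw [h1, h2]
  linear_combination (qPochInf p p)⁻¹ ^ 2 * h3

/-- The Weierstrass three-term addition formula. -/
theorem theta_three_term {p a b c w : ℂ} (hp0 : p ≠ 0) (hp : ‖p‖ < 1) (ha : a ≠ 0)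
    (hb : b ≠ 0) (hc : c ≠ 0) (hw : w ≠ 0) :
    theta (a * w) p * theta (-(a / w)) p * (theta (-(b * c)) p * theta (b / c) p) +
      b / c * (theta (-(a * b)) p * theta (a / b) p * (theta (c * w) p * theta (-(c / w)) p)) =
      theta (-(a * c)) p * theta (a / c) p * (theta (b * w) p * theta (-(b / w)) p) := by
  obtain ⟨E, O, h⟩ := exists_theta_mul_theta hp0 hp
  have hI := Complex.I_ne_zero
  have hIw : ∀ d : ℂ, d ≠ 0 → theta (d * w) p * theta (-(d / w)) p =
      Complex.I * d * (O (Complex.I * d) * E (-Complex.I * w) -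
        E (Complex.I * d) * O (-Complex.I * w)) := fun d hd => by
    rw [← h _ _ (mul_ne_zero hI hd) (mul_ne_zero (neg_ne_zero.2 hI) hw)]
    congr 2
    · linear_combination (d * w) * Complex.I_sq
    · field_simp
  have hII : ∀ d d' : ℂ, d ≠ 0 → d' ≠ 0 → theta (-(d * d')) p * theta (d / d') p =
      Complex.I * d * (O (Complex.I * d) * E (Complex.I * d') -
        E (Complex.I * d) * O (Complex.I * d')) := fun d d' hd hd' => by
    rw [← h _ _ (mul_ne_zero hI hd) (mul_ne_zero hI hd')]
    congr 2
    · linear_combination -(d * d') * Complex.I_sq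
    · field_simp
  rw [hIw a ha, hIw b hb, hIw c hc, hII b c hb hc, hII a b ha hb, hII a c ha hc]
  field_simp
  ring

/-- The theta function identity underlying the quadratic relation for the `c`-function. -/
theorem theta_askeyWilson_duality {p A C L U X Z e : ℂ} (hp0 : p ≠ 0) (hp : ‖p‖ < 1)
    (hA : A ≠ 0) (hC : C ≠ 0) (hL : L ≠ 0) (hU : U ≠ 0) (hX : X ≠ 0) (hZ : Z ≠ 0)
    (he : A * C * e = -p) (hA2 : theta (-(A ^ 2)) p ≠ 0) (hX2 : theta (X ^ 2) p ≠ 0) :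
    theta (Z ^ 2) p *
        (theta (A * X * L) p * theta (-(A * X / L)) p *
            (theta (C * X * U) p * theta (-(C * X / U)) p) *
            (theta (e * X * Z) p * theta (e * X / Z) p) -
          X ^ 2 * (theta (A / X * L) p * theta (-(A / X / L)) p *
            (theta (C / X * U) p * theta (-(C / X / U)) p) *
            (theta (e / X / Z) p * theta (e * Z / X) p))) =
      theta (X ^ 2) p *
        (theta (A * Z * U) p * theta (-(A * Z / U)) p *
            (theta (C * Z * L) p * theta (-(C * Z / L)) p) *
            (theta (e * X * Z) p * theta (e * Z / X) p) -
          Z ^ 2 * (theta (A / Z * U) p * theta (-(A / Z / U)) p *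
            (theta (C / Z * L) p * theta (-(C / Z / L)) p) *
            (theta (e / X / Z) p * theta (e * X / Z) p))) := by
  have he0 : e ≠ 0 := by
    rintro rfl
    exact hp0 (by simpa using he.symm)
  have heq : p = -(A * C * e) := by rw [he, neg_neg]
  have reflect : ∀ u v : ℂ, v ≠ 0 → -(u * v) = A * C * e → theta u p = theta v p := by
    intro u v hv huv
    rw [← theta_div hp0 (u := v)]
    congr 1
    rw [heq]
    field_simp
    linear_combination -huv
  have t3 := theta_three_term hp0 hp (mul_ne_zero hC hZ) (mul_ne_zero hA hX)
    (div_ne_zero hA hX) hL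
  have t4 := theta_three_term hp0 hp (div_ne_zero hC hZ) (mul_ne_zero hA hX)
    (div_ne_zero hA hX) hL
  have b1 := theta_three_term hp0 hp (div_ne_zero hC hX) (mul_ne_zero hA hZ)
    (div_ne_zero hA hZ) hU
  have b2 := theta_three_term hp0 hp (mul_ne_zero hC hX) (mul_ne_zero hA hZ)
    (div_ne_zero hA hZ) hU
  have m1 : A * X * (A / X) = A ^ 2 := by field_simp
  have m2 : A * X / (A / X) = X ^ 2 := by field_simp
  have m3 : A * Z * (A / Z) = A ^ 2 := by field_simp
  have m4 : A * Z / (A / Z) = Z ^ 2 := by field_simp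
  have r1 : theta (-(C * Z * (A * X))) p = theta (e / X / Z) p :=
    reflect _ _ (by simp [*]) (by field_simp)
  have r2 : theta (-(C * Z * (A / X))) p = theta (e * X / Z) p :=
    reflect _ _ (by simp [*]) (by field_simp)
  have r3 : theta (-(C / Z * (A * X))) p = theta (e * Z / X) p :=
    reflect _ _ (by simp [*]) (by field_simp)
  have r4 : theta (-(C / Z * (A / X))) p = theta (e * X * Z) p :=
    reflect _ _ (by simp [*]) (by field_simp)
  have r5 : -(C / X * (A * Z)) = -(C * Z * (A / X)) := by field_simp
  have r6 : -(C / X * (A / Z)) = -(C / Z * (A / X)) := by field_simp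
  have r7 : -(C * X * (A * Z)) = -(C * Z * (A * X)) := by ring
  have r8 : -(C * X * (A / Z)) = -(C / Z * (A * X)) := by field_simp
  have s1 : C / X / (A * Z) = C / Z / (A * X) := by field_simp
  have s2 : C / X / (A / Z) = C * Z / (A * X) := by field_simp
  have s3 : C * X / (A * Z) = C / Z / (A / X) := by field_simp
  have s4 : C * X / (A / Z) = C * Z / (A / X) := by field_simp
  rw [m1, m2, r1, r2] at t3
  rw [m1, m2, r3, r4] at t4
  rw [m3, m4, r5, r6, r2, r4, s1, s2] at b1
  rw [m3, m4, r7, r8, r1, r3, s3, s4] at b2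
  refine mul_left_cancel₀ (mul_ne_zero hA2 hX2) ?_
  linear_combination
    theta (X ^ 2) p * (theta (A * X * L) p * theta (-(A * X / L)) p) *
        (theta (e * X * Z) p * theta (e * X / Z) p) * b2 -
      theta (X ^ 2) p * X ^ 2 * (theta (A / X * L) p * theta (-(A / X / L)) p) *
        (theta (e / X / Z) p * theta (e * Z / X) p) * b1 -
      theta (X ^ 2) p * (theta (A * Z * U) p * theta (-(A * Z / U)) p) *
        (theta (e * X * Z) p * theta (e * Z / X) p) * t3 +
      theta (X ^ 2) p * Z ^ 2 * (theta (A / Z * U) p * theta (-(A / Z / U)) p) *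
        (theta (e / X / Z) p * theta (e * X / Z) p) * t4

theorem qc_ne_zero (q : ℝ) (x : ℂ) : qc q x ≠ 0 := Complex.exp_ne_zero _

theorem qc_add (q : ℝ) (x y : ℂ) : qc q (x + y) = qc q x * qc q y := by
  rw [qc, add_mul, Complex.exp_add]
  rfl

theorem qc_neg (q : ℝ) (x : ℂ) : qc q (-x) = (qc q x)⁻¹ := by
  rw [qc, neg_mul, Complex.exp_neg]
  rfl

theorem qc_sub (q : ℝ) (x y : ℂ) : qc q (x - y) = qc q x / qc q y := by
  rw [sub_eq_add_neg, qc_add, qc_neg, div_eq_mul_inv]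

theorem qc_neg_two_mul (q : ℝ) (x : ℂ) : qc q (-(2 * x)) = (qc q x ^ 2)⁻¹ := by
  rw [qc_neg, two_mul, qc_add, sq]

theorem qc_ofReal {q : ℝ} (hq : 0 ≤ q) (x : ℝ) : qc q x = (Real.exp (x * Real.log q) : ℝ) := by
  rw [qc, ← Complex.ofReal_log hq]
  push_cast
  rfl

theorem norm_qc_lt_one {q s : ℝ} (hq0 : 0 < q) (hq1 : q < 1) (hs : 0 < s) : ‖qc q s‖ < 1 := by
  rw [qc_ofReal hq0.le, Complex.norm_real, Real.norm_of_nonneg (Real.exp_pos _).le,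
    Real.exp_lt_one_iff]
  exact mul_neg_of_pos_of_neg hs (Real.log_neg hq0 hq1)

/-- The theta function with a positive real nome has no negative real zeros. -/
theorem theta_neg_ofReal_ne_zero {r p : ℝ} (hr : 0 < r) (hp0 : 0 < p) (hp1 : ‖(p : ℂ)‖ < 1) :
    theta (-(r : ℂ)) p ≠ 0 := by
  have key : ∀ t : ℝ, 0 < t → qPochInf (-(t : ℂ)) p ≠ 0 := fun t ht =>
    qPochInf_ne_zero hp1 _ fun i => by
      have : (0 : ℝ) < 1 + t * p ^ i := by positivity
      rw [neg_mul, sub_neg_eq_add]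
      exact_mod_cast this.ne'
  refine mul_ne_zero (key r hr) ?_
  rw [div_neg, ← Complex.ofReal_div]
  exact key _ (div_pos hp0 hr)

theorem qc_half_sq (q s : ℝ) : qc q (s / 2) * qc q (s / 2) = qc q s := by
  rw [← qc_add, add_halves]

theorem theta_dP_mul_qc (q s up sg : ℝ) (x : ℂ) :
    theta (dP q s up sg * qc q x) (qc q s) =
      theta (-(qc q (s / 2) * qc q sg / qc q x / qc q up)) (qc q s) := by
  rw [← theta_div (qc_ne_zero q s), dP, qc_sub, qc_add, ← qc_half_sq]
  have := qc_ne_zero q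
  congr 1
  field_simp [this]

theorem Wgt_swap (q s k lm up : ℝ) (x z : ℂ) : Wgt q s k up lm z x = Wgt q s k lm up x z := by
  rw [Wgt, Wgt, mul_comm (_ + _ + z)]

theorem cF_eq (q s k lm up sg : ℝ) (x z : ℂ) :
    cF q s k lm up sg x z =
      theta (qc q k / qc q z * qc q up) (qc q s) * theta (-(qc q k / qc q z / qc q up)) (qc q s) *
        theta (qc q (s / 2) * qc q sg / qc q z * qc q lm) (qc q s) *
        theta (-(qc q (s / 2) / (qc q sg * qc q k)) * qc q x / qc q z) (qc q s) /
      (Wgt q s k lm up x z * (theta (qc q z ^ 2)⁻¹ (qc q s) *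
        theta (-(qc q (s / 2) * qc q sg / qc q x / qc q up)) (qc q s))) := by
  have h := qc_ne_zero q
  rw [cF, theta_dP_mul_qc, qc_neg_two_mul]
  congr 1
  simp only [aP, bP, cP, dP, qc_add, qc_sub, qc_neg]
  congr 1
  · congr 1
    · congr 2
      · field_simp [h]
      · field_simp [h]
    · congr 1
      field_simp [h]
  · congr 1
    field_simp [h]

/-- the quadratic identity for the normalized c-function:
`c(x,z)c^d(z,-x)c^d(-z,-x) + c(-x,z)c^d(z,x)c^d(-z,-x)
  = c(x,z)c(-x,z)c^d(-z,-x) + c(x,z)c(-x,-z)c^d(z,-x)`. -/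
theorem stmt7 (q s k lm up sg : ℝ) (hq0 : 0 < q) (hq1 : q < 1) (hs : 0 < s) (x z : ℂ)
    (hth1 : theta (qc q (-(2 * z))) (qc q s) * theta (dP q s up sg * qc q x) (qc q s) ≠ 0)
    (hth2 : theta (qc q (-(2 * z))) (qc q s) * theta (dP q s up sg * qc q (-x)) (qc q s) ≠ 0)
    (hth3 : theta (qc q (-(2 * (-z)))) (qc q s) *
      theta (dP q s up sg * qc q (-x)) (qc q s) ≠ 0)
    (hth4 : theta (qc q (-(2 * x))) (qc q s) * theta (dP q s lm sg * qc q z) (qc q s) ≠ 0)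
    (hth5 : theta (qc q (-(2 * (-x)))) (qc q s) *
      theta (dP q s lm sg * qc q z) (qc q s) ≠ 0)
    (hth6 : theta (qc q (-(2 * (-x)))) (qc q s) *
      theta (dP q s lm sg * qc q (-z)) (qc q s) ≠ 0) :
    cF q s k lm up sg x z * cF q s k up lm sg z (-x) * cF q s k up lm sg (-z) (-x) +
      cF q s k lm up sg (-x) z * cF q s k up lm sg z x * cF q s k up lm sg (-z) (-x) =
    cF q s k lm up sg x z * cF q s k lm up sg (-x) z * cF q s k up lm sg (-z) (-x) +
      cF q s k lm up sg x z * cF q s k lm up sg (-x) (-z) * cF q s k up lm sg z (-x) := by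
  have hp := norm_qc_lt_one hq0 hq1 hs
  have hA2 : theta (-(qc q k ^ 2)) (qc q s) ≠ 0 := by
    rw [qc_ofReal hq0.le s] at hp ⊢
    rw [qc_ofReal hq0.le k, ← Complex.ofReal_pow]
    exact theta_neg_ofReal_ne_zero (by positivity) (Real.exp_pos _) hp
  simp only [theta_dP_mul_qc, qc_neg_two_mul, mul_ne_zero_iff] at hth1 hth2 hth3 hth4 hth5 hth6
  simp only [qc_neg, inv_pow, inv_inv, div_inv_eq_mul] at hth2 hth3 hth5 hth6
  simp only [cF_eq, Wgt_swap q s k lm up, qc_neg, inv_pow, inv_inv, div_inv_eq_mul]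
  have hp0 := qc_ne_zero q s
  have hA := qc_ne_zero q k
  have hL := qc_ne_zero q lm
  have hU := qc_ne_zero q up
  have hX := qc_ne_zero q x
  have hZ := qc_ne_zero q z
  have hG := qc_ne_zero q sg
  have hH := qc_ne_zero q (s / 2)
  have hpH := qc_half_sq q s
  have hW1 : Wgt q s k lm up x z ≠ 0 := qc_ne_zero _ _
  have hW2 : Wgt q s k lm up (-x) z ≠ 0 := qc_ne_zero _ _
  have hW3 : Wgt q s k lm up (-x) (-z) ≠ 0 := qc_ne_zero _ _
  generalize Wgt q s k lm up x z = W1, Wgt q s k lm up (-x) z = W2,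
    Wgt q s k lm up (-x) (-z) = W3 at *
  generalize qc q s = p, qc q k = A, qc q lm = L, qc q up = U, qc q x = X, qc q z = Z,
    qc q sg = G, qc q (s / 2) = H at *
  have N := theta_askeyWilson_duality (C := H * G) (e := -(H / (G * A))) hp0 hp hA
    (mul_ne_zero hH hG) hL hU hX hZ (by rw [← hpH]; field_simp) hA2 hth5.1
  generalize -(H / (G * A)) = e, H * G = C at *
  have hiX : theta (X ^ 2)⁻¹ p = -theta (X ^ 2) p / X ^ 2 := by
    rw [← theta_inv hp (pow_ne_zero 2 hX), mul_div_cancel_left₀ _ (pow_ne_zero 2 hX)]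
  have hiZ : theta (Z ^ 2)⁻¹ p = -theta (Z ^ 2) p / Z ^ 2 := by
    rw [← theta_inv hp (pow_ne_zero 2 hZ), mul_div_cancel_left₀ _ (pow_ne_zero 2 hZ)]
  rw [hiX, hiZ, mul_right_comm e Z X, mul_right_comm e Z⁻¹ X, mul_right_comm e X⁻¹ Z,
    ← div_eq_mul_inv (e * X), ← div_eq_mul_inv (e * Z), ← div_eq_mul_inv e X]
  obtain ⟨-, hdX⟩ := hth1
  obtain ⟨-, hdX'⟩ := hth2
  obtain ⟨htZ, -⟩ := hth3
  obtain ⟨-, hdZ⟩ := hth4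
  obtain ⟨htX, -⟩ := hth5
  obtain ⟨-, hdZ'⟩ := hth6
  clear hiX hiZ hA2 hp
  generalize theta (X ^ 2) p = tX, theta (Z ^ 2) p = tZ, theta (-(C / X / U)) p = dX,
    theta (-(C * X / U)) p = dX', theta (-(C / Z / L)) p = dZ,
    theta (-(C * Z / L)) p = dZ' at *
  generalize theta (e * X * Z) p = e₁, theta (e * X / Z) p = e₂, theta (e * Z / X) p = e₃,
    theta (e / X / Z) p = e₄ at *
  generalize theta (A * X * L) p = a₁, theta (-(A * X / L)) p = b₁, theta (C * X * U) p = c₁,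
    theta (A / X * L) p = a₂, theta (-(A / X / L)) p = b₂, theta (C / X * U) p = c₂,
    theta (A * Z * U) p = a₃, theta (-(A * Z / U)) p = b₃, theta (C * Z * L) p = c₃,
    theta (A / Z * U) p = a₄, theta (-(A / Z / U)) p = b₄, theta (C / Z * L) p = c₄ at *
  linear_combination (norm := (field_simp; ring))
    -(Z ^ 2 * (a₄ * b₄ * c₄) * (a₁ * b₁ * c₁) * e₂ /
      (W1 * W2 * W3 * tZ ^ 2 * tX ^ 2 * dX * dX' * dZ * dZ')) * N

end
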